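/- Let i ≠ j ∈ {1,2,3,4} with i + j ≢ 0 (mod 5). Then there is no homeomorphism h of ℂℙ² onto itself with h(Z(𝔐_i)) = Z(𝔐_j); thus 𝔐_i and 𝔐_j, which have isomorphic combinatorics, form a Zariski pair. -/

import Mathlib

/- The complex projective plane `ℂℙ²`, with its quotient topology, and projective
lines given as zero loci of linear forms in the homogeneous coordinates. -/

open scoped LinearAlgebra.Projectivization
open Projectivization

noncomputable section

abbrev CP2 := ℙ ℂ (Fin 3 → ℂ)

instance : TopologicalSpace CP2 :=
  inferInstanceAs (TopologicalSpace (Quotient (projectivizationSetoid ℂ (Fin 3 → ℂ))))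

/-- The projective line `{[x:y:z] | a*x + b*y + c*z = 0}`.  (The zero locus of a linear
form is well defined on any representative, so we may use the representative `p.rep`.) -/
def projLine (a b c : ℂ) : Set CP2 :=
  {p | a * p.rep 0 + b * p.rep 1 + c * p.rep 2 = 0}

/-- The lines of the arrangement `M_i`, where `α = ζ^i`:
`L1: z=0`, `L2: x=0`, `L3: (α²+α)x−(α+1)y+z=0`, `L4: y=0`, `L5: y−z=0`, `L6: x−z=0`,
`L7: αx−(α+1)y+z=0`, `L8: (α²+α)x−(α²+α+1)y+z=0`, `L9: αx−y+z=0`, `L10: α³x+y=0`. -/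
def Mline (α : ℂ) : Fin 10 → Set CP2 :=
  ![projLine 0 0 1,
    projLine 1 0 0,
    projLine (α^2 + α) (-(α + 1)) 1,
    projLine 0 1 0,
    projLine 0 1 (-1),
    projLine 1 0 (-1),
    projLine α (-(α + 1)) 1,
    projLine (α^2 + α) (-(α^2 + α + 1)) 1,
    projLine α (-1) 1,
    projLine (α^3) 1 0]

/-- The lines of the arrangement `𝔐_i = M_i ∪ {L11}`, where
`L11: (α²+2α+1)x+(α³−α−2)y+z=0`. -/
def MMline (α : ℂ) : Fin 11 → Set CP2 :=
  Fin.snoc (Mline α) (projLine (α^2 + 2*α + 1) (α^3 - α - 2) 1)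

/-! ### Linear forms on the projective plane -/

def ev (l v : Fin 3 → ℂ) : ℂ := l 0 * v 0 + l 1 * v 1 + l 2 * v 2

def rt (l m : Fin 3 → ℂ) (p : CP2) : ℂ := ev l p.rep / ev m p.rep

def ln (l : Fin 3 → ℂ) : Set CP2 := {p | ev l p.rep = 0}

def cr (l m : Fin 3 → ℂ) : Fin 3 → ℂ :=
  ![l 1 * m 2 - l 2 * m 1, l 2 * m 0 - l 0 * m 2, l 0 * m 1 - l 1 * m 0]

lemma ev_smul (l v : Fin 3 → ℂ) (c : ℂ) : ev l (c • v) = c * ev l v := by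
  simp [ev]; ring

lemma ev_add (l v w : Fin 3 → ℂ) : ev l (v + w) = ev l v + ev l w := by
  simp [ev]; ring

lemma ev_mk_rep (v : Fin 3 → ℂ) (hv : v ≠ 0) :
    ∃ a : ℂ, a ≠ 0 ∧ ∀ l, ev l (Projectivization.mk ℂ v hv).rep = a * ev l v := by
  obtain ⟨a, ha⟩ := Projectivization.exists_smul_eq_mk_rep ℂ v hv
  refine ⟨a, a.ne_zero, fun l => ?_⟩
  rw [← ha, Units.smul_def, ev_smul]

lemma mem_ln_mk (l v : Fin 3 → ℂ) (hv : v ≠ 0) :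
    Projectivization.mk ℂ v hv ∈ ln l ↔ ev l v = 0 := by
  obtain ⟨a, ha, h⟩ := ev_mk_rep v hv
  simp [ln, h, ha]

lemma rt_mk (l m v : Fin 3 → ℂ) (hv : v ≠ 0) :
    rt l m (Projectivization.mk ℂ v hv) = ev l v / ev m v := by
  obtain ⟨a, ha, h⟩ := ev_mk_rep v hv
  simp only [rt, h]
  rw [mul_div_mul_left _ _ ha]

lemma isQuot : Topology.IsQuotientMap (fun v : {v : Fin 3 → ℂ // v ≠ 0} =>
    (Projectivization.mk ℂ v.1 v.2 : CP2)) := isQuotientMap_quotient_mk'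

lemma cont_mk {X : Type*} [TopologicalSpace X] (f : X → Fin 3 → ℂ) (hf : Continuous f)
    (h : ∀ x, f x ≠ 0) : Continuous (fun x => (Projectivization.mk ℂ (f x) (h x) : CP2)) :=
  isQuot.continuous.comp (hf.subtype_mk h)

lemma ev_cont (l : Fin 3 → ℂ) : Continuous (ev l) := by
  unfold ev; fun_prop

lemma isClosed_ln (l : Fin 3 → ℂ) : IsClosed (ln l) := by
  rw [← isQuot.isClosed_preimage]
  have : (fun v : {v : Fin 3 → ℂ // v ≠ 0} =>
    (Projectivization.mk ℂ v.1 v.2 : CP2)) ⁻¹' ln l = {v | ev l v.1 = 0} := by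
    ext v; simp [mem_ln_mk]
  rw [this]
  exact isClosed_eq ((ev_cont l).comp continuous_subtype_val) continuous_const

lemma rt_cont (l m : Fin 3 → ℂ) : ContinuousOn (rt l m) (ln m)ᶜ := by
  rw [isQuot.continuousOn_isOpen_iff (isClosed_ln m).isOpen_compl]
  have : (rt l m ∘ fun v : {v : Fin 3 → ℂ // v ≠ 0} =>
    (Projectivization.mk ℂ v.1 v.2 : CP2)) = fun v => ev l v.1 / ev m v.1 := by
    ext v; simp [rt_mk]
  rw [this]
  apply ContinuousOn.div
  · exact ((ev_cont l).comp continuous_subtype_val).continuousOn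
  · exact ((ev_cont m).comp continuous_subtype_val).continuousOn
  · intro v hv
    simpa [mem_ln_mk] using hv

/-! ### Logarithms -/

lemma exists_log {X : Type*} [TopologicalSpace X] [LocallyPathConnectedSpace X]
    [SimplyConnectedSpace X] (F : X → ℂ) (hF : Continuous F) (h0 : ∀ x, F x ≠ 0) :
    ∃ Φ : X → ℂ, Continuous Φ ∧ ∀ x, Complex.exp (Φ x) = F x := by
  obtain ⟨x₀⟩ : Nonempty X := inferInstance
  obtain ⟨f, ⟨-, hf⟩, -⟩ := Complex.isCoveringMapOn_exp.existsUnique_continuousMap_lifts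
    (⟨F, hF⟩ : C(X, ℂ)) (a₀ := x₀) (Complex.exp_log (h0 x₀)) (fun x => h0 x)
  exact ⟨f, f.continuous, fun x => congrFun hf x⟩

lemma const_of_exp {X : Type*} [TopologicalSpace X] [PreconnectedSpace X] (g : X → ℂ)
    (hg : Continuous g) (x₀ : X) (h : ∀ x, Complex.exp (g x) = Complex.exp (g x₀)) (x : X) :
    g x = g x₀ := by
  have h1 : ∀ x, ∃ n : ℤ, g x = g x₀ + n * (2 * Real.pi * Complex.I) :=
    fun x => Complex.exp_eq_exp_iff_exists_int.1 (h x)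
  have key : ∀ x, ∃ n : ℤ, (g x - g x₀) / (2 * Real.pi * Complex.I) = n := by
    intro x
    obtain ⟨n, hn⟩ := h1 x
    refine ⟨n, ?_⟩
    rw [hn, add_sub_cancel_left, mul_div_cancel_right₀ _ Complex.two_pi_I_ne_zero]
  choose n hn using key
  have hc : Continuous n := by
    have h2 : Continuous (fun x => ((n x : ℤ) : ℝ)) := by
      have : (fun x => ((n x : ℤ) : ℝ)) =
          fun x => ((g x - g x₀) / (2 * Real.pi * Complex.I)).re := by
        ext x; rw [hn]; simp
      rw [this]
      fun_prop
    exact Int.isClosedEmbedding_coe_real.isInducing.continuous_iff.2 h2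
  have := PreconnectedSpace.constant inferInstance hc (x := x) (y := x₀)
  have h3 := hn x
  rw [this, ← hn x₀, sub_self, zero_div] at h3
  rw [div_eq_zero_iff] at h3
  rcases h3 with h3 | h3
  · exact sub_eq_zero.1 h3
  · exact absurd h3 Complex.two_pi_I_ne_zero

/-- the basic winding lemma -/
lemma wind (ψ : ℂ → ℂ) (hψ : Continuous ψ) (N : ℤ) (C : ℂ)
    (h : ∀ s, Complex.exp (ψ s) = C * Complex.exp s ^ N)
    (hp : ψ (2 * Real.pi * Complex.I) = ψ 0) : N = 0 ∧ ∀ s, ψ s = ψ 0 := by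
  have h1 := const_of_exp (fun s => ψ s - N * s) (by fun_prop) 0 (by
    intro s
    simp only [Complex.exp_sub, h, Complex.exp_int_mul]
    simp
    rw [mul_div_cancel_right₀]
    exact zpow_ne_zero _ (Complex.exp_ne_zero s))
  have hN : N = 0 := by
    have := h1 (2 * Real.pi * Complex.I)
    simp only [hp, mul_zero, sub_zero] at this
    have h3 : (N : ℂ) * (2 * Real.pi * Complex.I) = 0 := by linear_combination -this
    rcases mul_eq_zero.1 h3 with h4 | h4
    · exact_mod_cast h4
    · exact absurd h4 Complex.two_pi_I_ne_zero
  refine ⟨hN, fun s => ?_⟩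
  have := h1 s
  simpa [hN] using this

/-! ### Coordinates adapted to two lines -/

lemma cr_basis (l m : Fin 3 → ℂ) (h : cr l m ≠ 0) :
    ∃ n e1 e2 e3 : Fin 3 → ℂ, ev l e1 = 1 ∧ ev m e1 = 0 ∧ ev l e2 = 0 ∧ ev m e2 = 1 ∧
      ev l e3 = 0 ∧ ev m e3 = 0 ∧
      ∀ v, v = ev l v • e1 + ev m v • e2 + ev n v • e3 := by
  set n : Fin 3 → ℂ := fun i => starRingEnd ℂ (cr l m i) with hn
  set d : ℂ := ev n (cr l m) with hd
  have hd0 : d ≠ 0 := by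
    have h2 : d = ((‖cr l m 0‖ ^ 2 + ‖cr l m 1‖ ^ 2 + ‖cr l m 2‖ ^ 2 : ℝ) : ℂ) := by
      simp only [hd, hn, ev, Complex.conj_mul']
      push_cast; ring
    rw [h2]
    norm_cast
    intro h3
    apply h
    have h0 := sq_nonneg ‖cr l m 0‖
    have h1 := sq_nonneg ‖cr l m 1‖
    have h2 := sq_nonneg ‖cr l m 2‖
    ext i
    fin_cases i
    · have : ‖cr l m 0‖ ^ 2 = 0 := by linarith
      simpa using this
    · have : ‖cr l m 1‖ ^ 2 = 0 := by linarith
      simpa using this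
    · have : ‖cr l m 2‖ ^ 2 = 0 := by linarith
      simpa using this
  clear_value n
  have hd' : d = n 0 * (l 1 * m 2 - l 2 * m 1) + n 1 * (l 2 * m 0 - l 0 * m 2)
    + n 2 * (l 0 * m 1 - l 1 * m 0) := by simp [hd, ev, cr]
  clear_value d
  refine ⟨n, d⁻¹ • cr m n, d⁻¹ • cr n l, d⁻¹ • cr l m, ?_, ?_, ?_, ?_, ?_, ?_, ?_⟩
  · rw [ev_smul, inv_mul_eq_one₀ hd0, hd']; simp [ev, cr]; ring
  · rw [ev_smul]; simp [ev, cr]; right; ring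
  · rw [ev_smul]; simp [ev, cr]; right; ring
  · rw [ev_smul, inv_mul_eq_one₀ hd0, hd']; simp [ev, cr]; ring
  · rw [ev_smul]; simp [ev, cr]; right; ring
  · rw [ev_smul]; simp [ev, cr]; right; ring
  · intro v
    ext i
    apply mul_left_cancel₀ hd0
    fin_cases i
    · simp only [Fin.zero_eta, Pi.add_apply, Pi.smul_apply, smul_eq_mul, mul_add]
      field_simp
      rw [hd']; simp [ev, cr]; ring
    · simp only [Fin.mk_one, Pi.add_apply, Pi.smul_apply, smul_eq_mul, mul_add]
      field_simp
      rw [hd']; simp [ev, cr]; ring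
    · simp only [Fin.reduceFinMk, Pi.add_apply, Pi.smul_apply, smul_eq_mul, mul_add]
      field_simp
      rw [hd']; simp [ev, cr]; ring


lemma mk_eq_of_smul (x : CP2) (v : Fin 3 → ℂ) (hv : v ≠ 0) (c : ℂ) (h : x.rep = c • v) :
    Projectivization.mk ℂ v hv = x := by
  rw [← Projectivization.mk_rep x, Projectivization.mk_eq_mk_iff']
  have hc : c ≠ 0 := by
    rintro rfl
    exact x.rep_nonzero (by simpa using h)
  exact ⟨c⁻¹, by rw [h, smul_smul, inv_mul_cancel₀ hc, one_smul]⟩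

lemma not_mem_iff (l m : Fin 3 → ℂ) (x : CP2) :
    x ∈ (ln l ∪ ln m)ᶜ ↔ ev l x.rep ≠ 0 ∧ ev m x.rep ≠ 0 := by
  simp [ln]

lemma pair (l m : Fin 3 → ℂ) (h : cr l m ≠ 0) (F : CP2 → ℂ)
    (hF : ContinuousOn F (ln l ∪ ln m)ᶜ) (h0 : ∀ x ∈ (ln l ∪ ln m)ᶜ, F x ≠ 0) :
    ∃ (N : ℤ) (φ : CP2 → ℂ), ContinuousOn φ (ln l ∪ ln m)ᶜ ∧
      ∀ x ∈ (ln l ∪ ln m)ᶜ, F x = rt l m x ^ N * Complex.exp (φ x) := by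
  obtain ⟨n, e1, e2, e3, h1, h2, h3, h4, h5, h6, hv⟩ := cr_basis l m h
  have evl : ∀ p : ℂ × ℂ, ev l (Complex.exp p.2 • e1 + e2 + p.1 • e3) = Complex.exp p.2 := by
    intro p; simp only [ev_add, ev_smul, h1, h3, h5]; ring
  have evm : ∀ p : ℂ × ℂ, ev m (Complex.exp p.2 • e1 + e2 + p.1 • e3) = 1 := by
    intro p; simp only [ev_add, ev_smul, h2, h4, h6]; ring
  have hne : ∀ p : ℂ × ℂ, Complex.exp p.2 • e1 + e2 + p.1 • e3 ≠ 0 := by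
    intro p hp
    have := evm p
    rw [hp] at this
    simp [ev] at this
  set Ψ : ℂ × ℂ → CP2 := fun p => Projectivization.mk ℂ _ (hne p) with hΨ
  have hΨc : Continuous Ψ := cont_mk _ (by fun_prop) hne
  have hΨm : ∀ p, Ψ p ∈ (ln l ∪ ln m)ᶜ := by
    intro p
    simp only [Set.mem_compl_iff, Set.mem_union, not_or, hΨ, mem_ln_mk, evl, evm]
    exact ⟨Complex.exp_ne_zero _, one_ne_zero⟩
  obtain ⟨Φ, hΦc, hΦ⟩ := exists_log (F ∘ Ψ) (hF.comp_continuous hΨc hΨm) (fun p => h0 _ (hΨm p))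
  have hper : ∀ w s, Ψ (w, s + 2 * Real.pi * Complex.I) = Ψ (w, s) := by
    intro w s
    simp only [hΨ, Complex.exp_periodic s]
  have hD := const_of_exp (fun p : ℂ × ℂ => Φ (p.1, p.2 + 2 * Real.pi * Complex.I) - Φ p)
    (by fun_prop) 0 (by
      intro p
      simp only [Complex.exp_sub, hΦ, Function.comp_apply, hper]
      have a := h0 _ (hΨm p)
      have b := h0 _ (hΨm 0)
      exact (div_self a).trans (div_self b).symm)
  obtain ⟨N, hN⟩ : ∃ N : ℤ, Φ ((0 : ℂ × ℂ).1, (0 : ℂ × ℂ).2 + 2 * Real.pi * Complex.I) - Φ 0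
      = N * (2 * Real.pi * Complex.I) := by
    rw [← Complex.exp_eq_one_iff, Complex.exp_sub, hΦ, hΦ, Function.comp_apply, hper]
    exact div_self (h0 _ (hΨm 0))
  set G : ℂ → ℂ → ℂ := fun w s => Φ (w, s) - N * s with hG
  have hGper : ∀ w, Function.Periodic (G w) (2 * Real.pi * Complex.I) := by
    intro w s
    have := hD (w, s)
    rw [hN] at this
    simp only [hG]
    linear_combination this
  have hGe : ∀ w s s', Complex.exp s = Complex.exp s' → G w s = G w s' := by
    intro w s s' hs
    obtain ⟨k, rfl⟩ := Complex.exp_eq_exp_iff_exists_int.1 hs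
    exact (hGper w).int_mul k s'
  have hx : ∀ x ∈ (ln l ∪ ln m)ᶜ, ∀ s, Complex.exp s = rt l m x → Ψ (rt n m x, s) = x := by
    intro x hx s hs
    rw [not_mem_iff] at hx
    apply mk_eq_of_smul x _ _ (ev m x.rep)
    conv_lhs => rw [hv x.rep]
    rw [hs]
    simp only [rt, smul_add, smul_smul]
    rw [mul_div_cancel₀ _ hx.2, mul_div_cancel₀ _ hx.2]
  have hu0 : ∀ x ∈ (ln l ∪ ln m)ᶜ, rt l m x ≠ 0 := by
    intro x hx
    rw [not_mem_iff] at hx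
    exact div_ne_zero hx.1 hx.2
  have hsub : (ln l ∪ ln m)ᶜ ⊆ (ln m)ᶜ := by
    intro x hx hx'; exact hx (Or.inr hx')
  refine ⟨N, fun x => G (rt n m x) (Complex.log (rt l m x)), ?_, ?_⟩
  · intro x₀ hx₀
    have c1 : ContinuousWithinAt (rt l m) (ln l ∪ ln m)ᶜ x₀ := ((rt_cont l m).mono hsub) x₀ hx₀
    have c2 : ContinuousWithinAt (rt n m) (ln l ∪ ln m)ᶜ x₀ := ((rt_cont n m).mono hsub) x₀ hx₀
    have c3 : ContinuousWithinAt (fun x => G (rt n m x)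
        (Complex.log (rt l m x / rt l m x₀) + Complex.log (rt l m x₀))) (ln l ∪ ln m)ᶜ x₀ := by
      have c4 : ContinuousWithinAt (fun x => Complex.log (rt l m x / rt l m x₀)
          + Complex.log (rt l m x₀)) (ln l ∪ ln m)ᶜ x₀ := by
        apply ContinuousWithinAt.add _ continuousWithinAt_const
        apply ContinuousWithinAt.clog (c1.div_const _)
        rw [div_self (hu0 _ hx₀)]
        exact Complex.one_mem_slitPlane
      have c5 : Continuous (fun p : ℂ × ℂ => G p.1 p.2) := by
        simp only [hG]; fun_prop
      exact c5.continuousAt.comp_continuousWithinAt (c2.prodMk c4)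
    refine c3.congr (fun x hx => ?_) ?_
    · apply hGe
      rw [Complex.exp_add, Complex.exp_log (hu0 _ hx), Complex.exp_log (hu0 _ hx₀),
        Complex.exp_log (div_ne_zero (hu0 _ hx) (hu0 _ hx₀)), div_mul_cancel₀ _ (hu0 _ hx₀)]
    · apply hGe
      rw [div_self (hu0 _ hx₀)]; simp
  · intro x hx'
    have hl := Complex.exp_log (hu0 x hx')
    simp only [hG, Complex.exp_sub, hΦ, Function.comp_apply, hx x hx' _ hl, Complex.exp_int_mul,
      hl]
    rw [mul_div_cancel₀]
    exact zpow_ne_zero _ (hu0 x hx')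

lemma pair_unique (l m : Fin 3 → ℂ) (h : cr l m ≠ 0) (N : ℤ) (φ : CP2 → ℂ)
    (hφ : ContinuousOn φ (ln l ∪ ln m)ᶜ)
    (he : ∀ x ∈ (ln l ∪ ln m)ᶜ, rt l m x ^ N = Complex.exp (φ x)) : N = 0 := by
  obtain ⟨n, e1, e2, e3, h1, h2, h3, h4, h5, h6, hv⟩ := cr_basis l m h
  have evl : ∀ s : ℂ, ev l (Complex.exp s • e1 + e2) = Complex.exp s := by
    intro p; simp only [ev_add, ev_smul, h1, h3]; ring
  have evm : ∀ s : ℂ, ev m (Complex.exp s • e1 + e2) = 1 := by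
    intro p; simp only [ev_add, ev_smul, h2, h4]; ring
  have hne : ∀ s : ℂ, Complex.exp s • e1 + e2 ≠ 0 := by
    intro p hp
    have := evm p
    rw [hp] at this
    simp [ev] at this
  have hΨc : Continuous (fun s => (Projectivization.mk ℂ _ (hne s) : CP2)) :=
    cont_mk _ (by fun_prop) hne
  have hΨm : ∀ s, (Projectivization.mk ℂ _ (hne s) : CP2) ∈ (ln l ∪ ln m)ᶜ := by
    intro p
    simp only [Set.mem_compl_iff, Set.mem_union, not_or, mem_ln_mk, evl, evm]
    exact ⟨Complex.exp_ne_zero _, one_ne_zero⟩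
  refine (wind (fun s => φ (Projectivization.mk ℂ _ (hne s))) (hφ.comp_continuous hΨc hΨm)
    N 1 ?_ ?_).1
  · intro s
    rw [← he _ (hΨm s), rt_mk, evl, evm]; simp
  · simp [Complex.exp_two_pi_mul_I]

lemma unit (h : CP2 ≃ₜ CP2) (l m l' m' : Fin 3 → ℂ) (hlm : cr l m ≠ 0) (hlm' : cr l' m' ≠ 0)
    (hl : ∀ x, h x ∈ ln l' ↔ x ∈ ln l) (hm : ∀ x, h x ∈ ln m' ↔ x ∈ ln m) :
    ∃ (N : ℤ) (φ : CP2 → ℂ), (N = 1 ∨ N = -1) ∧ ContinuousOn φ (ln l ∪ ln m)ᶜ ∧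
      ∀ x ∈ (ln l ∪ ln m)ᶜ, rt l' m' (h x) = rt l m x ^ N * Complex.exp (φ x) := by
  have key : ∀ (h : CP2 ≃ₜ CP2) (l m l' m' : Fin 3 → ℂ) (hlm : cr l m ≠ 0)
      (hl : ∀ x, h x ∈ ln l' ↔ x ∈ ln l) (hm : ∀ x, h x ∈ ln m' ↔ x ∈ ln m),
      ∃ (N : ℤ) (φ : CP2 → ℂ), ContinuousOn φ (ln l ∪ ln m)ᶜ ∧
      ∀ x ∈ (ln l ∪ ln m)ᶜ, rt l' m' (h x) = rt l m x ^ N * Complex.exp (φ x) := by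
    intro h l m l' m' hlm hl hm
    refine pair l m hlm (fun x => rt l' m' (h x)) ?_ ?_
    · refine (rt_cont l' m').comp h.continuous.continuousOn ?_
      intro x hx hx'
      exact hx (Or.inr ((hm x).1 hx'))
    · intro x hx
      have : h x ∈ (ln l' ∪ ln m')ᶜ := by
        simp only [Set.mem_compl_iff, Set.mem_union, not_or, hl, hm] at hx ⊢
        exact hx
      rw [not_mem_iff] at this
      exact div_ne_zero this.1 this.2
  obtain ⟨N, φ, hφ, hN⟩ := key h l m l' m' hlm hl hm
  obtain ⟨N', φ', hφ', hN'⟩ := key h.symm l' m' l m hlm'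
    (fun x => by simpa using (hl (h.symm x)).symm) (fun x => by simpa using (hm (h.symm x)).symm)
  have hmaps : Set.MapsTo h (ln l ∪ ln m)ᶜ (ln l' ∪ ln m')ᶜ := by
    intro x hx
    simp only [Set.mem_compl_iff, Set.mem_union, not_or, hl, hm] at hx ⊢
    exact hx
  have hz : 1 - N * N' = 0 := by
    refine pair_unique l m hlm _ (fun x => φ x * N' + φ' (h x)) ?_ ?_
    · exact (hφ.mul continuousOn_const).add (hφ'.comp h.continuous.continuousOn hmaps)
    · intro x hx
      have h1 := hN x hx
      have h2 := hN' (h x) (hmaps hx)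
      rw [h.symm_apply_apply, h1, mul_zpow, ← zpow_mul, ← Complex.exp_int_mul, mul_assoc,
        ← Complex.exp_add, mul_comm (N' : ℂ)] at h2
      have hu : rt l m x ≠ 0 := by
        rw [not_mem_iff] at hx
        exact div_ne_zero hx.1 hx.2
      rw [zpow_sub₀ hu, zpow_one, div_eq_iff (zpow_ne_zero _ hu)]
      rw [mul_comm]; exact h2
  refine ⟨N, φ, ?_, hφ, hN⟩
  exact Int.eq_one_or_neg_one_of_mul_eq_one (by linarith : N * N' = 1)


/-! ### The key relation along a line -/

lemma rt_ratio (l k m n : Fin 3 → ℂ) (d : ev m (cr l k) = 0) (hk : ev k (cr l n) ≠ 0)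
    (x : CP2) (hx : x ∈ ln l) :
    rt m n x = ev m (cr l n) / ev k (cr l n) * rt k n x := by
  have hx' : ev l x.rep = 0 := hx
  have e : ev m x.rep * ev k (cr l n) = ev m (cr l n) * ev k x.rep := by
    have e2 : ev m x.rep * ev k (cr l n) - ev m (cr l n) * ev k x.rep
      = ev n x.rep * -(ev m (cr l k)) + ev l x.rep * ev n (cr k m) := by
      simp [ev, cr]; ring
    rw [d, hx'] at e2
    linear_combination e2
  simp only [rt]
  rw [div_mul_div_comm, ← e, mul_comm (ev k (cr l n)), mul_div_mul_right _ _ hk]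

lemma line_span (l k n : Fin 3 → ℂ) (y : Fin 3 → ℂ) (hy : ev l y = 0) :
    ev n (cr l k) • y = ev n y • cr l k + (- ev k y) • cr l n := by
  simp only [ev] at hy
  ext i
  fin_cases i
  · simp [ev, cr]
    linear_combination (n 2 * k 1 - n 1 * k 2) * hy
  · simp [ev, cr]
    linear_combination (n 0 * k 2 - n 2 * k 0) * hy
  · simp [ev, cr]
    linear_combination (n 1 * k 0 - n 0 * k 1) * hy

lemma key_rel (h : CP2 ≃ₜ CP2) (l k m n l' k' m' n' : Fin 3 → ℂ)
    (hl : ∀ x, h x ∈ ln l' ↔ x ∈ ln l)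
    (d : ev m (cr l k) = 0) (d' : ev m' (cr l' k') = 0)
    (hn : ev n (cr l k) ≠ 0) (hm : ev m (cr l n) ≠ 0)
    (hk' : ev k' (cr l' n') ≠ 0) (hm' : ev m' (cr l' n') ≠ 0)
    (Nk Nm : ℤ) (φk φm : CP2 → ℂ)
    (ck : ContinuousOn φk (ln k ∪ ln n)ᶜ) (cm : ContinuousOn φm (ln m ∪ ln n)ᶜ)
    (uk : ∀ x ∈ (ln k ∪ ln n)ᶜ, rt k' n' (h x) = rt k n x ^ Nk * Complex.exp (φk x))
    (um : ∀ x ∈ (ln m ∪ ln n)ᶜ, rt m' n' (h x) = rt m n x ^ Nm * Complex.exp (φm x)) :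
    Nk = Nm ∧ ∀ p q, p ∈ ln l → q ∈ ln l → p ∉ ln k → q ∉ ln k → p ∉ ln n → q ∉ ln n →
      φk p - φm p = φk q - φm q := by
  have hkn : ev k (cr l n) = - ev n (cr l k) := by simp [ev, cr]; ring
  have hk : ev k (cr l n) ≠ 0 := by rw [hkn]; exact neg_ne_zero.2 hn
  have lk : ev l (cr l k) = 0 := by simp [ev, cr]; ring
  have lnn : ev l (cr l n) = 0 := by simp [ev, cr]; ring
  have kk : ev k (cr l k) = 0 := by simp [ev, cr]; ring
  have nn : ev n (cr l n) = 0 := by simp [ev, cr]; ring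
  set c := ev m (cr l n) / ev k (cr l n) with hc
  set c' := ev m' (cr l' n') / ev k' (cr l' n') with hc'
  have hc0 : c ≠ 0 := div_ne_zero hm hk
  have hc0' : c' ≠ 0 := div_ne_zero hm' hk'
  have main : ∀ x ∈ ln l, x ∉ ln k → x ∉ ln n →
      x ∈ (ln k ∪ ln n)ᶜ ∧ x ∈ (ln m ∪ ln n)ᶜ ∧
      Complex.exp (φk x - φm x) = c ^ Nm / c' * rt k n x ^ (Nm - Nk) := by
    intro x xl xk xn
    have r1 := rt_ratio l k m n d hk x xl
    have r2 := rt_ratio l' k' m' n' d' hk' (h x) ((hl x).2 xl)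
    have u0 : rt k n x ≠ 0 := div_ne_zero xk xn
    have xm : x ∉ ln m := by
      intro xm
      have : rt m n x = 0 := by
        have : ev m x.rep = 0 := xm
        simp [rt, this]
      rw [this] at r1
      exact mul_ne_zero hc0 u0 r1.symm
    have a1 : x ∈ (ln k ∪ ln n)ᶜ := by simp [xk, xn]
    have a2 : x ∈ (ln m ∪ ln n)ᶜ := by simp [xm, xn]
    refine ⟨a1, a2, ?_⟩
    have e1 := uk x a1
    have e2 := um x a2
    rw [r2, r1, e1, mul_zpow] at e2
    rw [Complex.exp_sub, zpow_sub₀ u0, div_mul_div_comm, div_eq_div_iff (Complex.exp_ne_zero _)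
      (mul_ne_zero hc0' (zpow_ne_zero _ u0))]
    linear_combination e2
  have evl : ∀ s : ℂ, ev l (cr l k + (-Complex.exp s) • cr l n) = 0 := by
    intro s; rw [ev_add, ev_smul, lk, lnn]; ring
  have evk : ∀ s : ℂ, ev k (cr l k + (-Complex.exp s) • cr l n)
      = Complex.exp s * ev n (cr l k) := by
    intro s; rw [ev_add, ev_smul, kk, hkn]; ring
  have evn : ∀ s : ℂ, ev n (cr l k + (-Complex.exp s) • cr l n) = ev n (cr l k) := by
    intro s; rw [ev_add, ev_smul, nn]; ring
  have hne : ∀ s : ℂ, cr l k + (-Complex.exp s) • cr l n ≠ 0 := by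
    intro s hs
    have := evn s
    rw [hs] at this
    apply hn
    rw [← this]; simp [ev]
  set γ : ℂ → CP2 := fun s => Projectivization.mk ℂ _ (hne s) with hγ
  have γc : Continuous γ := cont_mk _ (by fun_prop) hne
  have γl : ∀ s, γ s ∈ ln l := fun s => by simp only [hγ, mem_ln_mk, evl]
  have γk : ∀ s, γ s ∉ ln k := fun s => by
    simp only [hγ, mem_ln_mk, evk]; exact mul_ne_zero (Complex.exp_ne_zero _) hn
  have γn : ∀ s, γ s ∉ ln n := fun s => by simp only [hγ, mem_ln_mk, evn]; exact hn
  have γr : ∀ s, rt k n (γ s) = Complex.exp s := fun s => by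
    simp only [hγ, rt_mk, evk, evn]; rw [mul_div_cancel_right₀ _ hn]
  have W := wind (fun s => φk (γ s) - φm (γ s))
    ((ck.comp_continuous γc fun s => (main _ (γl s) (γk s) (γn s)).1).sub
      (cm.comp_continuous γc fun s => (main _ (γl s) (γk s) (γn s)).2.1)) (Nm - Nk) (c ^ Nm / c')
    (by
      intro s
      rw [(main _ (γl s) (γk s) (γn s)).2.2, γr])
    (by simp [hγ, Complex.exp_two_pi_mul_I])
  refine ⟨by linarith [W.1], ?_⟩
  have sur : ∀ p, p ∈ ln l → p ∉ ln k → p ∉ ln n → ∃ s, p = γ s := by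
    intro p pl pk pn
    refine ⟨Complex.log (ev k p.rep / ev n p.rep), ?_⟩
    symm
    apply mk_eq_of_smul _ _ _ (ev n p.rep / ev n (cr l k))
    rw [Complex.exp_log (div_ne_zero pk pn)]
    have := line_span l k n p.rep pl
    have h2 : p.rep = (ev n (cr l k))⁻¹ • (ev n (cr l k) • p.rep) := by
      rw [smul_smul, inv_mul_cancel₀ hn, one_smul]
    conv_lhs => rw [h2, this]
    rw [smul_add, smul_add, smul_smul, smul_smul, smul_smul]
    have pn' : ev n p.rep ≠ 0 := pn
    congr 2
    · field_simp
    · field_simp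
  intro p q pl ql pk qk pn qn
  obtain ⟨s, rfl⟩ := sur p pl pk pn
  obtain ⟨t, rfl⟩ := sur q ql qk qn
  exact (W.2 s).trans (W.2 t).symm


/-! ### An integer model of the ring of fifth cyclotomic integers -/

abbrev Q4 := ℤ × ℤ × ℤ × ℤ

def qmul (x y : Q4) : Q4 :=
  let c4 := x.2.1 * y.2.2.2 + x.2.2.1 * y.2.2.1 + x.2.2.2 * y.2.1
  let c5 := x.2.2.1 * y.2.2.2 + x.2.2.2 * y.2.2.1
  let c6 := x.2.2.2 * y.2.2.2
  (x.1 * y.1 - c4 + c5,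
   x.1 * y.2.1 + x.2.1 * y.1 - c4 + c6,
   x.1 * y.2.2.1 + x.2.1 * y.2.1 + x.2.2.1 * y.1 - c4,
   x.1 * y.2.2.2 + x.2.1 * y.2.2.1 + x.2.2.1 * y.2.1 + x.2.2.2 * y.1 - c4)

def qe (α : ℂ) (x : Q4) : ℂ := x.1 + x.2.1 * α + x.2.2.1 * α ^ 2 + x.2.2.2 * α ^ 3

lemma qe_mul (α : ℂ) (hα : α ^ 4 + α ^ 3 + α ^ 2 + α + 1 = 0) (x y : Q4) :
    qe α (qmul x y) = qe α x * qe α y := by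
  obtain ⟨a, b, c, d⟩ := x
  obtain ⟨a', b', c', d'⟩ := y
  simp only [qe, qmul]
  push_cast
  linear_combination (-((b : ℂ) * d' + c * c' + d * b') - (c * d' + d * c') * (α - 1)
    - d * d' * (α ^ 2 - α)) * hα

lemma qe_sub (α : ℂ) (x y : Q4) : qe α (x - y) = qe α x - qe α y := by
  simp only [qe, Prod.fst_sub, Prod.snd_sub]
  push_cast; ring

lemma qe_add (α : ℂ) (x y : Q4) : qe α (x + y) = qe α x + qe α y := by
  simp only [qe, Prod.fst_add, Prod.snd_add]
  push_cast; ring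

lemma prim5 (α : ℂ) (hα : α ^ 4 + α ^ 3 + α ^ 2 + α + 1 = 0) : IsPrimitiveRoot α 5 := by
  have h5 : α ^ 5 = 1 := by linear_combination (α - 1) * hα
  rw [IsPrimitiveRoot.iff_orderOf]
  have : Fact (Nat.Prime 5) := ⟨by norm_num⟩
  refine orderOf_eq_prime h5 ?_
  rintro rfl
  norm_num at hα

lemma cubic_zero (a b c d : ℚ) (h : Polynomial.C d * Polynomial.X ^ 3 +
    Polynomial.C c * Polynomial.X ^ 2 + Polynomial.C b * Polynomial.X +
    Polynomial.C a = 0) : a = 0 ∧ b = 0 ∧ c = 0 ∧ d = 0 := by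
  have h0 := congrArg (fun p => Polynomial.coeff p 0) h
  have h1 := congrArg (fun p => Polynomial.coeff p 1) h
  have h2 := congrArg (fun p => Polynomial.coeff p 2) h
  have h3 := congrArg (fun p => Polynomial.coeff p 3) h
  simp [Polynomial.coeff_X, Polynomial.coeff_C, Polynomial.coeff_X_pow] at h0 h1 h2 h3
  exact ⟨h0, h1, h2, h3⟩

lemma qe_eq_zero (α : ℂ) (hα : α ^ 4 + α ^ 3 + α ^ 2 + α + 1 = 0) (x : Q4) (h : qe α x = 0) :
    x = 0 := by
  obtain ⟨a, b, c, d⟩ := x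
  set p : Polynomial ℚ := Polynomial.C (d : ℚ) * Polynomial.X ^ 3 +
    Polynomial.C (c : ℚ) * Polynomial.X ^ 2 + Polynomial.C (b : ℚ) * Polynomial.X +
    Polynomial.C (a : ℚ) with hp
  have hpe : Polynomial.aeval α p = 0 := by
    simp [hp]
    simp only [qe] at h
    linear_combination h
  have hp0 : p = 0 := by
    by_contra hne
    have h1 := minpoly.degree_le_of_ne_zero ℚ α hne hpe
    rw [← Polynomial.cyclotomic_eq_minpoly_rat (prim5 α hα) (by norm_num),
      Polynomial.degree_cyclotomic] at h1
    have h2 : p.degree ≤ 3 := Polynomial.degree_cubic_le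
    have h3 := h1.trans h2
    rw [Nat.totient_prime (by norm_num)] at h3
    norm_cast at h3
  obtain ⟨h0, h1, h2, h3⟩ := cubic_zero _ _ _ _ hp0
  norm_cast at h0 h1 h2 h3
  simp [h0, h1, h2, h3]

def lz : Fin 11 → Q4 × Q4 × Q4 :=
  ![((0, 0, 0, 0), (0, 0, 0, 0), (1, 0, 0, 0)),
    ((1, 0, 0, 0), (0, 0, 0, 0), (0, 0, 0, 0)),
    ((0, 1, 1, 0), (-1, -1, 0, 0), (1, 0, 0, 0)),
    ((0, 0, 0, 0), (1, 0, 0, 0), (0, 0, 0, 0)),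
    ((0, 0, 0, 0), (1, 0, 0, 0), (-1, 0, 0, 0)),
    ((1, 0, 0, 0), (0, 0, 0, 0), (-1, 0, 0, 0)),
    ((0, 1, 0, 0), (-1, -1, 0, 0), (1, 0, 0, 0)),
    ((0, 1, 1, 0), (-1, -1, -1, 0), (1, 0, 0, 0)),
    ((0, 1, 0, 0), (-1, 0, 0, 0), (1, 0, 0, 0)),
    ((0, 0, 0, 1), (1, 0, 0, 0), (0, 0, 0, 0)),
    ((1, 2, 1, 0), (-2, -1, 0, 1), (1, 0, 0, 0))]

def lv (α : ℂ) (k : Fin 11) : Fin 3 → ℂ := ![qe α (lz k).1, qe α (lz k).2.1, qe α (lz k).2.2]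

def dz (i j k : Fin 11) : Q4 :=
  qmul (lz i).1 (qmul (lz j).2.1 (lz k).2.2 - qmul (lz j).2.2 (lz k).2.1) +
  qmul (lz i).2.1 (qmul (lz j).2.2 (lz k).1 - qmul (lz j).1 (lz k).2.2) +
  qmul (lz i).2.2 (qmul (lz j).1 (lz k).2.1 - qmul (lz j).2.1 (lz k).1)

abbrev T (i j k : Fin 11) : Prop := dz i j k = 0

lemma ev_lv (α : ℂ) (hα : α ^ 4 + α ^ 3 + α ^ 2 + α + 1 = 0) (i j k : Fin 11) :
    ev (lv α i) (cr (lv α j) (lv α k)) = 0 ↔ T i j k := by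
  have : ev (lv α i) (cr (lv α j) (lv α k)) = qe α (dz i j k) := by
    simp only [dz, qe_add, qe_sub, qe_mul α hα]
    simp [ev, cr, lv]
  rw [this]
  constructor
  · exact qe_eq_zero α hα _
  · intro h
    rw [h]; simp [qe]

lemma MMline_eq (α : ℂ) (k : Fin 11) : MMline α k = ln (lv α k) := by
  have : MMline α k = projLine (lv α k 0) (lv α k 1) (lv α k 2) := by
    fin_cases k <;> change projLine _ _ _ = _ <;> congr 1 <;> simp [lv, lz, qe] <;> ring
  rw [this]; rfl

lemma T_ne : ∀ j k : Fin 11, j ≠ k → ∃ i, ¬ T i j k := by decide +kernel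

lemma cr_ne (α : ℂ) (hα : α ^ 4 + α ^ 3 + α ^ 2 + α + 1 = 0) (j k : Fin 11) (h : j ≠ k) :
    cr (lv α j) (lv α k) ≠ 0 := by
  obtain ⟨i, hi⟩ := T_ne j k h
  intro h0
  apply hi
  rw [← ev_lv α hα, h0]
  simp [ev]


/-! ### A homeomorphism permutes the lines -/

lemma inter_unique (l m : Fin 3 → ℂ) (h : cr l m ≠ 0) (x y : CP2) (xl : x ∈ ln l) (xm : x ∈ ln m)
    (yl : y ∈ ln l) (ym : y ∈ ln m) : x = y := by
  obtain ⟨n, e1, e2, e3, h1, h2, h3, h4, h5, h6, hv⟩ := cr_basis l m h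
  have key : ∀ x : CP2, x ∈ ln l → x ∈ ln m → x.rep = ev n x.rep • e3 := by
    intro x xl xm
    have xl' : ev l x.rep = 0 := xl
    have xm' : ev m x.rep = 0 := xm
    conv_lhs => rw [hv x.rep, xl', xm']
    simp
  have he : e3 ≠ 0 := by
    intro h0
    have := key x xl xm
    rw [h0, smul_zero] at this
    exact x.rep_nonzero this
  rw [← mk_eq_of_smul x e3 he _ (key x xl xm), ← mk_eq_of_smul y e3 he _ (key y yl ym)]

lemma one_line (h : CP2 ≃ₜ CP2) (l m n : Fin 3 → ℂ) (hd : ev n (cr l m) ≠ 0)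
    (L' : Fin 11 → Fin 3 → ℂ) (hL' : ∀ j k, j ≠ k → cr (L' j) (L' k) ≠ 0)
    (hu : ∀ x ∈ ln l, ∃ k, h x ∈ ln (L' k)) : ∃ k, ∀ x ∈ ln l, h x ∈ ln (L' k) := by
  have hmn : ev m (cr l n) = - ev n (cr l m) := by simp [ev, cr]; ring
  have lm : ev l (cr l m) = 0 := by simp [ev, cr]; ring
  have lnn : ev l (cr l n) = 0 := by simp [ev, cr]; ring
  have mm : ev m (cr l m) = 0 := by simp [ev, cr]; ring
  have nn : ev n (cr l n) = 0 := by simp [ev, cr]; ring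
  have evl : ∀ s : ℂ, ev l (cr l m + s • cr l n) = 0 := by
    intro s; rw [ev_add, ev_smul, lm, lnn]; ring
  have evm : ∀ s : ℂ, ev m (cr l m + s • cr l n) = - s * ev n (cr l m) := by
    intro s; rw [ev_add, ev_smul, mm, hmn]; ring
  have evn : ∀ s : ℂ, ev n (cr l m + s • cr l n) = ev n (cr l m) := by
    intro s; rw [ev_add, ev_smul, nn]; ring
  have hne : ∀ s : ℂ, cr l m + s • cr l n ≠ 0 := by
    intro s hs
    have := evn s
    rw [hs] at this
    apply hd
    rw [← this]; simp [ev]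
  set γ : ℂ → CP2 := fun s => Projectivization.mk ℂ _ (hne s) with hγ
  have γc : Continuous γ := cont_mk _ (by fun_prop) hne
  have γl : ∀ s, γ s ∈ ln l := fun s => by simp only [hγ, mem_ln_mk, evl]
  have γr : ∀ s, rt m n (γ s) = - s := fun s => by
    simp only [hγ, rt_mk, evm, evn]; rw [mul_div_cancel_right₀ _ hd]
  have γi : Function.Injective γ := by
    intro s t hst
    have := γr s
    rw [hst, γr t] at this
    exact (neg_injective this).symm
  set F : Fin 11 → Set ℂ := fun k => {s | h (γ s) ∈ ln (L' k)} with hF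
  have Fc : ∀ k, IsClosed (F k) := fun k =>
    (isClosed_ln (L' k)).preimage (h.continuous.comp γc)
  set S : Set ℂ := ⋃ j, ⋃ k, {s | j ≠ k ∧ s ∈ F j ∧ s ∈ F k} with hS
  have Sc : S.Countable := by
    refine Set.countable_iUnion fun j => Set.countable_iUnion fun k => ?_
    apply Set.Subsingleton.countable
    rintro s ⟨hjk, s1, s2⟩ t ⟨-, t1, t2⟩
    exact γi (h.injective (inter_unique _ _ (hL' j k hjk) _ _ s1 s2 t1 t2))
  have conn : IsConnected Sᶜ := Sc.isConnected_compl_of_one_lt_rank (by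
    rw [Complex.rank_real_complex]; norm_num)
  have dens : Dense Sᶜ := Sc.dense_compl ℝ
  have hex : ∀ s, ∃ k, s ∈ F k := fun s => hu _ (γl s)
  choose c hc using hex
  have cc : Continuous (fun s : (Sᶜ : Set ℂ) => c s.1) := by
    rw [continuous_iff_isClosed]
    intro A _
    have : (fun s : (Sᶜ : Set ℂ) => c s.1) ⁻¹' A = ⋃ k ∈ A, (fun s : (Sᶜ : Set ℂ) => s.1) ⁻¹' F k := by
      ext s
      simp only [Set.mem_preimage, Set.mem_iUnion, exists_prop]
      constructor
      · intro hs; exact ⟨_, hs, hc _⟩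
      · rintro ⟨k, kA, hk⟩
        by_cases e : c s.1 = k
        · rw [e]; exact kA
        · exfalso
          apply s.2
          simp only [hS, Set.mem_iUnion]
          exact ⟨_, _, e, hc _, hk⟩
    rw [this]
    exact (Set.toFinite A).isClosed_biUnion fun k _ => (Fc k).preimage continuous_subtype_val
  have : PreconnectedSpace (Sᶜ : Set ℂ) := Subtype.preconnectedSpace conn.isPreconnected
  obtain ⟨s₀, hs₀⟩ := conn.nonempty
  have hall : ∀ s, s ∈ F (c s₀) := by
    have h1 : Sᶜ ⊆ F (c s₀) := by
      intro s hs
      have := PreconnectedSpace.constant inferInstance cc (x := ⟨s, hs⟩) (y := ⟨s₀, hs₀⟩)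
      simp only at this
      rw [← this]; exact hc s
    have h2 : closure Sᶜ ⊆ F (c s₀) := (Fc _).closure_subset_iff.2 h1
    intro s
    exact h2 (dens s)
  have hn : ∀ x ∈ ln l, x ∉ ln n → h x ∈ ln (L' (c s₀)) := by
    intro x xl xn
    have xn' : ev n x.rep ≠ 0 := xn
    have : x = γ (- rt m n x) := by
      symm
      apply mk_eq_of_smul _ _ _ (ev n x.rep / ev n (cr l m))
      have := line_span l m n x.rep xl
      have h2 : x.rep = (ev n (cr l m))⁻¹ • (ev n (cr l m) • x.rep) := by
        rw [smul_smul, inv_mul_cancel₀ hd, one_smul]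
      conv_lhs => rw [h2, this]
      rw [smul_add, smul_add, smul_smul, smul_smul, smul_smul]
      simp only [rt]
      congr 2
      · field_simp
      · field_simp
    rw [this]
    exact hall _
  refine ⟨c s₀, fun x xl => ?_⟩
  by_cases xn : x ∈ ln n
  swap
  · exact hn x xl xn
  have evm' : ∀ t : ℂ, ev m (t • cr l m + cr l n) = - ev n (cr l m) := by
    intro t; rw [ev_add, ev_smul, mm, hmn]; ring
  have evn' : ∀ t : ℂ, ev n (t • cr l m + cr l n) = t * ev n (cr l m) := by
    intro t; rw [ev_add, ev_smul, nn]; ring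
  have evl' : ∀ t : ℂ, ev l (t • cr l m + cr l n) = 0 := by
    intro t; rw [ev_add, ev_smul, lm, lnn]; ring
  have hne' : ∀ t : ℂ, t • cr l m + cr l n ≠ 0 := by
    intro s hs
    have := evm' s
    rw [hs] at this
    apply hd
    rw [← neg_eq_zero, ← this]; simp [ev]
  have δc : Continuous (fun t => (Projectivization.mk ℂ _ (hne' t) : CP2)) :=
    cont_mk _ (by fun_prop) hne'
  have cl : IsClosed {t | h (Projectivization.mk ℂ _ (hne' t)) ∈ ln (L' (c s₀))} :=
    (isClosed_ln _).preimage (h.continuous.comp δc)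
  have h1 : ({0}ᶜ : Set ℂ) ⊆ {t | h (Projectivization.mk ℂ _ (hne' t)) ∈ ln (L' (c s₀))} := by
    intro t ht
    apply hn
    · rw [mem_ln_mk, evl']
    · rw [mem_ln_mk, evn']; exact mul_ne_zero ht hd
  have h2 := cl.closure_subset_iff.2 h1
  have h3 : (0 : ℂ) ∈ closure ({0}ᶜ : Set ℂ) := (dense_compl_singleton (0 : ℂ)) 0
  have h4 := h2 h3
  have h5 : Projectivization.mk ℂ _ (hne' 0) = x := by
    apply mk_eq_of_smul _ _ _ (- ev m x.rep / ev n (cr l m))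
    have := line_span l m n x.rep xl
    have xn' : ev n x.rep = 0 := xn
    have h2 : x.rep = (ev n (cr l m))⁻¹ • (ev n (cr l m) • x.rep) := by
      rw [smul_smul, inv_mul_cancel₀ hd, one_smul]
    conv_lhs => rw [h2, this, xn']
    rw [zero_smul, zero_add, zero_add, smul_smul]
    congr 1
    field_simp
  rw [← h5]
  exact h4


/-! ### The permutation is trivial -/

lemma T_ne2 : ∀ j k : Fin 11, j ≠ k → ∃ i, ¬ T j k i := by decide +kernel

lemma T_ne3 : ∀ k : Fin 11, ∃ i j, ¬ T i k j := by decide +kernel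

lemma T_rep : ∀ i j : Fin 11, T i j j := by decide +kernel

def cnt (k : Fin 11) : ℕ := (Finset.univ.filter fun p : Fin 11 × Fin 11 => T k p.1 p.2).card

lemma third (σ : Fin 11 → Fin 11) (hi : Function.Injective σ)
    (hT : ∀ i j k, T (σ i) (σ j) (σ k) ↔ T i j k) (a b c a' b' c' : Fin 11)
    (ha : σ a = a') (hb : σ b = b') (hac : c ≠ a) (hbc : c ≠ b) (t : T a b c)
    (u : ∀ x, x ≠ a' → x ≠ b' → T a' b' x → x = c') : σ c = c' := by
  subst ha hb
  exact u _ (hi.ne hac) (hi.ne hbc) ((hT a b c).2 t)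

lemma cnt_inv (σ : Fin 11 → Fin 11) (hi : Function.Injective σ)
    (hT : ∀ i j k, T (σ i) (σ j) (σ k) ↔ T i j k) (k : Fin 11) : cnt (σ k) = cnt k := by
  have hb : Function.Bijective σ := Finite.injective_iff_bijective.1 hi
  symm
  unfold cnt
  refine Finset.card_bij (fun p _ => (σ p.1, σ p.2)) ?_ ?_ ?_
  · rintro ⟨a, b⟩ hab
    simp only [Finset.mem_filter, Finset.mem_univ, true_and] at hab ⊢
    exact (hT _ _ _).2 hab
  · rintro ⟨a, b⟩ _ ⟨c, d⟩ _ h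
    simp only [Prod.mk.injEq] at h
    rw [hi h.1, hi h.2]
  · rintro ⟨a, b⟩ hab
    obtain ⟨a', rfl⟩ := hb.2 a
    obtain ⟨b', rfl⟩ := hb.2 b
    simp only [Finset.mem_filter, Finset.mem_univ, true_and] at hab
    refine ⟨(a', b'), ?_, rfl⟩
    simp only [Finset.mem_filter, Finset.mem_univ, true_and]
    exact (hT _ _ _).1 hab

def tab : Fin 11 → ℕ := ![39, 39, 39, 39, 43, 41, 41, 43, 39, 39, 35]

lemma cnt_tab : ∀ k, cnt k = tab k := by decide +kernel
lemma cnt_a (x : Fin 11) (h : cnt x = cnt 10) : x = 10 := by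
  rw [cnt_tab, cnt_tab] at h; revert x; decide
lemma cnt_b (x : Fin 11) (h : cnt x = cnt 4) : x = 4 ∨ x = 7 := by
  rw [cnt_tab, cnt_tab] at h; revert x; decide
lemma cnt_c (x : Fin 11) (h : cnt x = cnt 7) : x = 4 ∨ x = 7 := by
  rw [cnt_tab, cnt_tab] at h; revert x; decide
lemma cnt_d (x : Fin 11) (h : cnt x = cnt 6) : x = 5 ∨ x = 6 := by
  rw [cnt_tab, cnt_tab] at h; revert x; decide

lemma perm_id (σ : Fin 11 → Fin 11) (hi : Function.Injective σ)
    (hT : ∀ i j k, T (σ i) (σ j) (σ k) ↔ T i j k) : ∀ k, σ k = k := by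
  have th := third σ hi hT
  have s10 : σ 10 = 10 := cnt_a _ (cnt_inv σ hi hT 10)
  have s4 := cnt_b _ (cnt_inv σ hi hT 4)
  have s7 := cnt_c _ (cnt_inv σ hi hT 7)
  have s6 := cnt_d _ (cnt_inv σ hi hT 6)
  have ne47 : σ 4 ≠ σ 7 := hi.ne (by decide)
  have ne56 : σ 5 ≠ σ 6 := hi.ne (by decide)
  rcases s4 with s4 | s4
  · have s7 : σ 7 = 7 := by
      rcases s7 with s7 | s7
      · exact absurd (s4.trans s7.symm) ne47
      · exact s7
    have s9 : σ 9 = 9 := th 10 4 9 10 4 9 s10 s4 (by decide) (by decide) (by decide +kernel)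
      (by decide +kernel)
    have s8 : σ 8 = 8 := th 10 7 8 10 7 8 s10 s7 (by decide) (by decide) (by decide +kernel)
      (by decide +kernel)
    have s1 : σ 1 = 1 := th 4 8 1 4 8 1 s4 s8 (by decide) (by decide) (by decide +kernel)
      (by decide +kernel)
    have s0 : σ 0 = 0 := th 7 9 0 7 9 0 s7 s9 (by decide) (by decide) (by decide +kernel)
      (by decide +kernel)
    have s5 : σ 5 = 5 := th 0 1 5 0 1 5 s0 s1 (by decide) (by decide) (by decide +kernel)
      (by decide +kernel)
    have s6 : σ 6 = 6 := by
      rcases s6 with s6 | s6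
      · exact absurd (s5.trans s6.symm) ne56
      · exact s6
    have s2 : σ 2 = 2 := th 0 8 2 0 8 2 s0 s8 (by decide) (by decide) (by decide +kernel)
      (by decide +kernel)
    have s3 : σ 3 = 3 := th 2 7 3 2 7 3 s2 s7 (by decide) (by decide) (by decide +kernel)
      (by decide +kernel)
    intro k
    fin_cases k <;> assumption
  · exfalso
    have s7 : σ 7 = 4 := by
      rcases s7 with s7 | s7
      · exact s7
      · exact absurd (s4.trans s7.symm) ne47
    have s9 : σ 9 = 8 := th 10 4 9 10 7 8 s10 s4 (by decide) (by decide) (by decide +kernel)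
      (by decide +kernel)
    have s8 : σ 8 = 9 := th 10 7 8 10 4 9 s10 s7 (by decide) (by decide) (by decide +kernel)
      (by decide +kernel)
    have s1 : σ 1 = 0 := th 4 8 1 7 9 0 s4 s8 (by decide) (by decide) (by decide +kernel)
      (by decide +kernel)
    have s0 : σ 0 = 1 := th 7 9 0 4 8 1 s7 s9 (by decide) (by decide) (by decide +kernel)
      (by decide +kernel)
    have s5 : σ 5 = 5 := th 0 1 5 1 0 5 s0 s1 (by decide) (by decide) (by decide +kernel)
      (by decide +kernel)
    have s6 : σ 6 = 6 := by
      rcases s6 with s6 | s6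
      · exact absurd (s5.trans s6.symm) ne56
      · exact s6
    have s2 : σ 2 = 3 := th 0 8 2 1 9 3 s0 s8 (by decide) (by decide) (by decide +kernel)
      (by decide +kernel)
    have := (hT 1 2 6).2 (by decide +kernel)
    rw [s1, s2, s6] at this
    revert this
    decide +kernel

lemma T_iff (α : ℂ) (hα : α ^ 4 + α ^ 3 + α ^ 2 + α + 1 = 0) (i j k : Fin 11) (hjk : j ≠ k) :
    T i j k ↔ ∃ x, x ∈ ln (lv α i) ∧ x ∈ ln (lv α j) ∧ x ∈ ln (lv α k) := by
  have hne := cr_ne α hα j k hjk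
  have m1 : Projectivization.mk ℂ _ hne ∈ ln (lv α j) := by
    rw [mem_ln_mk]; simp [ev, cr]; ring
  have m2 : Projectivization.mk ℂ _ hne ∈ ln (lv α k) := by
    rw [mem_ln_mk]; simp [ev, cr]; ring
  constructor
  · intro t
    refine ⟨Projectivization.mk ℂ _ hne, ?_, m1, m2⟩
    rw [mem_ln_mk]; exact (ev_lv α hα i j k).2 t
  · rintro ⟨x, xi, xj, xk⟩
    rw [inter_unique _ _ hne x _ xj xk m1 m2, mem_ln_mk] at xi
    exact (ev_lv α hα i j k).1 xi

lemma ln_inj (α : ℂ) (hα : α ^ 4 + α ^ 3 + α ^ 2 + α + 1 = 0) (k j : Fin 11)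
    (h : ∀ x ∈ ln (lv α k), x ∈ ln (lv α j)) : j = k := by
  by_contra hjk
  obtain ⟨i, hi⟩ := T_ne2 j k hjk
  have hki : k ≠ i := by
    rintro rfl
    exact hi (T_rep _ _)
  apply hi
  rw [T_iff α hα j k i hki]
  have m1 : Projectivization.mk ℂ _ (cr_ne α hα k i hki) ∈ ln (lv α k) := by
    rw [mem_ln_mk]; simp [ev, cr]; ring
  have m2 : Projectivization.mk ℂ _ (cr_ne α hα k i hki) ∈ ln (lv α i) := by
    rw [mem_ln_mk]; simp [ev, cr]; ring
  exact ⟨_, h _ m1, m1, m2⟩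

lemma fix_lines (α β : ℂ) (hα : α ^ 4 + α ^ 3 + α ^ 2 + α + 1 = 0)
    (hβ : β ^ 4 + β ^ 3 + β ^ 2 + β + 1 = 0) (h : CP2 ≃ₜ CP2)
    (hh : h '' (⋃ k, MMline α k) = ⋃ k, MMline β k) :
    ∀ k x, h x ∈ ln (lv β k) ↔ x ∈ ln (lv α k) := by
  simp only [MMline_eq] at hh
  have h1 : ∀ k, ∃ m, ∀ x ∈ ln (lv α k), h x ∈ ln (lv β m) := by
    intro k
    obtain ⟨i, j, hij⟩ := T_ne3 k
    refine one_line h (lv α k) (lv α j) (lv α i) ((ev_lv α hα i k j).not.2 hij) (lv β)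
      (fun j k hjk => cr_ne β hβ j k hjk) ?_
    intro x hx
    have : h x ∈ ⋃ k, ln (lv β k) := by
      rw [← hh]; exact ⟨x, Set.mem_iUnion.2 ⟨k, hx⟩, rfl⟩
    exact Set.mem_iUnion.1 this
  have h2 : ∀ k, ∃ m, ∀ x ∈ ln (lv β k), h.symm x ∈ ln (lv α m) := by
    intro k
    obtain ⟨i, j, hij⟩ := T_ne3 k
    refine one_line h.symm (lv β k) (lv β j) (lv β i) ((ev_lv β hβ i k j).not.2 hij) (lv α)
      (fun j k hjk => cr_ne α hα j k hjk) ?_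
    intro x hx
    have : x ∈ h '' ⋃ k, ln (lv α k) := by
      rw [hh]; exact Set.mem_iUnion.2 ⟨k, hx⟩
    obtain ⟨y, hy, rfl⟩ := this
    rw [h.symm_apply_apply]
    exact Set.mem_iUnion.1 hy
  choose σ hσ using h1
  choose τ hτ using h2
  have ts : ∀ k, τ (σ k) = k := by
    intro k
    apply ln_inj α hα
    intro x hx
    have := hτ _ _ (hσ k x hx)
    rwa [h.symm_apply_apply] at this
  have key : ∀ k x, h x ∈ ln (lv β (σ k)) ↔ x ∈ ln (lv α k) := by
    intro k x
    refine ⟨fun hx => ?_, hσ k x⟩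
    have := hτ _ _ hx
    rwa [h.symm_apply_apply, ts] at this
  have inj : Function.Injective σ := Function.LeftInverse.injective ts
  have hid := perm_id σ inj (by
    intro i j k
    by_cases hjk : j = k
    · subst hjk
      exact ⟨fun _ => T_rep _ _, fun _ => T_rep _ _⟩
    rw [T_iff β hβ _ _ _ (inj.ne hjk), T_iff α hα _ _ _ hjk]
    constructor
    · rintro ⟨x, a, b, c⟩
      refine ⟨h.symm x, (key _ _).1 ?_, (key _ _).1 ?_, (key _ _).1 ?_⟩ <;>
      rwa [h.apply_symm_apply]
    · rintro ⟨x, a, b, c⟩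
      exact ⟨h x, (key _ _).2 a, (key _ _).2 b, (key _ _).2 c⟩)
  intro k x
  have := key k x
  rwa [hid] at this


/-! ### The rigidity certificate -/

abbrev Cond (l k m a b c d : Fin 11) : Prop :=
  k ≠ 10 ∧ m ≠ 10 ∧ T m l k ∧ ¬ T 10 l k ∧ ¬ T m l 10 ∧ ¬ T k l 10 ∧ a ≠ b ∧ c ≠ d ∧
  T l a b ∧ T l c d ∧ ¬ T k a b ∧ ¬ T k c d ∧ ¬ T 10 a b ∧ ¬ T 10 c d

lemma certificate (φ : Fin 11 → Fin 11 → Fin 11 → ℂ)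
    (R : ∀ l k m a b c d, Cond l k m a b c d → φ k a b - φ m a b = φ k c d - φ m c d) :
    φ 1 2 4 + φ 7 3 5 = φ 7 2 4 + φ 1 3 5 := by
  have c0 := R 0 1 5 0 2 0 3 (by decide +kernel)
  have c1 := R 2 5 9 0 2 1 2 (by decide +kernel)
  have c2 := R 2 3 7 0 2 2 4 (by decide +kernel)
  have c3 := R 4 0 3 1 4 2 4 (by decide +kernel)
  have c4 := R 2 0 8 1 2 2 4 (by decide +kernel)
  have c5 := R 5 2 9 0 1 3 5 (by decide +kernel)
  have c6 := R 3 2 7 0 3 3 5 (by decide +kernel)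
  have c7 := R 4 5 6 0 3 2 4 (by decide +kernel)
  have c8 := R 9 0 7 1 3 2 5 (by decide +kernel)
  have c9 := R 3 2 7 0 3 1 3 (by decide +kernel)
  have c10 := R 2 1 6 0 2 2 4 (by decide +kernel)
  have c11 := R 3 0 4 1 3 3 5 (by decide +kernel)
  have c12 := R 5 0 1 2 5 3 5 (by decide +kernel)
  have c13 := R 8 3 6 0 2 1 4 (by decide +kernel)
  have c14 := R 1 3 9 0 1 1 2 (by decide +kernel)
  have c15 := R 6 3 8 0 6 1 2 (by decide +kernel)
  have c16 := R 6 1 2 0 6 4 5 (by decide +kernel)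
  have c17 := R 5 4 7 0 1 3 5 (by decide +kernel)
  have c18 := R 1 4 8 0 1 1 3 (by decide +kernel)
  have c19 := R 5 0 1 2 5 4 5 (by decide +kernel)
  have c20 := R 0 7 9 0 1 0 3 (by decide +kernel)
  have c21 := R 3 6 8 0 3 1 3 (by decide +kernel)
  have c22 := R 1 2 6 0 1 1 3 (by decide +kernel)
  have c23 := R 4 0 3 1 4 4 5 (by decide +kernel)
  have c24 := R 5 4 7 0 1 2 5 (by decide +kernel)
  have c25 := R 5 4 6 0 1 2 5 (by decide +kernel)
  have c26 := R 4 5 7 0 3 2 4 (by decide +kernel)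
  have c27 := R 2 1 6 0 2 2 5 (by decide +kernel)
  have c28 := R 4 1 8 0 3 2 4 (by decide +kernel)
  have c29 := R 4 5 6 0 3 1 4 (by decide +kernel)
  have c30 := R 1 0 5 1 2 1 4 (by decide +kernel)
  have c31 := R 0 7 9 0 1 0 2 (by decide +kernel)
  have c32 := R 3 1 9 0 3 3 5 (by decide +kernel)
  have c33 := R 6 4 5 0 6 1 2 (by decide +kernel)
  have c34 := R 0 3 4 0 1 0 6 (by decide +kernel)
  have c35 := R 7 2 3 0 7 4 5 (by decide +kernel)
  have c36 := R 9 2 5 0 7 1 3 (by decide +kernel)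
  have c37 := R 2 3 7 0 2 2 5 (by decide +kernel)
  have c38 := R 9 1 3 0 7 2 5 (by decide +kernel)
  have c39 := R 0 1 5 0 2 0 7 (by decide +kernel)
  have c40 := R 1 0 5 1 2 1 3 (by decide +kernel)
  have c41 := R 1 4 8 0 1 1 2 (by decide +kernel)
  have c42 := R 0 1 5 0 2 0 6 (by decide +kernel)
  have c43 := R 0 2 8 0 1 0 6 (by decide +kernel)
  linear_combination (1/5) * c0 + (1/5) * c1 + (-2/5) * c2 + (-2/5) * c3 + (2/5) * c4 + (-3/5) * c5 + (3/5) * c6 + (3/5) * c7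
    + (-3/5) * c8 + (-3/5) * c9 + (-3/5) * c10 + (2/5) * c11 + (-2/5) * c12 + (1/5) * c13 + (-1/5) * c14 + (1/5) * c15
    + (-1/5) * c16 + (2/5) * c17 + (-2/5) * c18 + (-1/5) * c19 + (3/5) * c20 + (2/5) * c21 + (2/5) * c22 + (1/5) * c23
    + (2/5) * c24 + (-2/5) * c25 + (-3/5) * c26 + (2/5) * c27 + (-2/5) * c28 + (-1/5) * c29 + (-1/5) * c30 + (1/5) * c31
    + (3/5) * c32 + (-1/5) * c33 + (1/5) * c34 + (-1/5) * c35 + (1/5) * c36 + (1/5) * c37 + (1/5) * c38 + (1/5) * c39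
    + (-1/5) * c40 + (1/5) * c41 + (-1/5) * c42 + (1/5) * c43

lemma cross (α : ℂ) (hα : α ^ 4 + α ^ 3 + α ^ 2 + α + 1 = 0) (p q : CP2)
    (p2 : p ∈ ln (lv α 2)) (p4 : p ∈ ln (lv α 4)) (q3 : q ∈ ln (lv α 3)) (q5 : q ∈ ln (lv α 5))
    (n : Fin 3 → ℂ) :
    rt (lv α 1) n p * rt (lv α 7) n q = α * (rt (lv α 7) n p * rt (lv α 1) n q) := by
  have hp : (![1, α + 1, α + 1] : Fin 3 → ℂ) ≠ 0 := fun h => by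
    simpa using congrFun h 0
  have hq : (![1, 0, 1] : Fin 3 → ℂ) ≠ 0 := fun h => by
    simpa using congrFun h 0
  have ep : p = Projectivization.mk ℂ _ hp := by
    refine inter_unique _ _ (cr_ne α hα 2 4 (by decide)) _ _ p2 p4 ?_ ?_
    · rw [mem_ln_mk]; simp [ev, lv, lz, qe]; ring
    · rw [mem_ln_mk]; simp [ev, lv, lz, qe]
  have eq : q = Projectivization.mk ℂ _ hq := by
    refine inter_unique _ _ (cr_ne α hα 3 5 (by decide)) _ _ q3 q5 ?_ ?_
    · rw [mem_ln_mk]; simp [ev, lv, lz, qe]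
    · rw [mem_ln_mk]; simp [ev, lv, lz, qe]
  rw [ep, eq, rt_mk, rt_mk, rt_mk, rt_mk, div_mul_div_comm, div_mul_div_comm, ← mul_div_assoc]
  congr 1
  simp [ev, lv, lz, qe]
  linear_combination hα

lemma rigid (α β : ℂ) (hα : α ^ 4 + α ^ 3 + α ^ 2 + α + 1 = 0)
    (hβ : β ^ 4 + β ^ 3 + β ^ 2 + β + 1 = 0) (h : CP2 ≃ₜ CP2)
    (hf : ∀ k x, h x ∈ ln (lv β k) ↔ x ∈ ln (lv α k)) :
    ∃ N : ℤ, (N = 1 ∨ N = -1) ∧ β = α ^ N := by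
  have hu : ∀ k : Fin 11, ∃ (N : ℤ) (φ : CP2 → ℂ), k ≠ 10 → ((N = 1 ∨ N = -1) ∧
      ContinuousOn φ (ln (lv α k) ∪ ln (lv α 10))ᶜ ∧
      ∀ x ∈ (ln (lv α k) ∪ ln (lv α 10))ᶜ, rt (lv β k) (lv β 10) (h x)
        = rt (lv α k) (lv α 10) x ^ N * Complex.exp (φ x)) := by
    intro k
    by_cases hk : k = 10
    · exact ⟨0, fun _ => 0, fun h => absurd hk h⟩
    · obtain ⟨N, φ, h1⟩ := unit h (lv α k) (lv α 10) (lv β k) (lv β 10) (cr_ne α hα _ _ hk)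
        (cr_ne β hβ _ _ hk) (hf k) (hf 10)
      exact ⟨N, φ, fun _ => h1⟩
  choose N φ hN using hu
  have hP : ∀ a b : Fin 11, ∃ x : CP2, a ≠ b → ∀ i, (x ∈ ln (lv α i) ↔ T i a b) := by
    intro a b
    by_cases hab : a = b
    · exact ⟨Projectivization.mk ℂ _ (cr_ne α hα 0 1 (by decide)), fun h => absurd hab h⟩
    · refine ⟨Projectivization.mk ℂ _ (cr_ne α hα a b hab), fun _ i => ?_⟩
      rw [mem_ln_mk]; exact ev_lv α hα i a b
  choose P hP using hP
  have R : ∀ l k m a b c d, Cond l k m a b c d → N k = N m ∧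
      φ k (P a b) - φ m (P a b) = φ k (P c d) - φ m (P c d) := by
    rintro l k m a b c d ⟨hk, hm, t1, t2, t3, t4, hab, hcd, t5, t6, t7, t8, t9, t10⟩
    have K := key_rel h (lv α l) (lv α k) (lv α m) (lv α 10) (lv β l) (lv β k) (lv β m) (lv β 10)
      (hf l) ((ev_lv α hα _ _ _).2 t1) ((ev_lv β hβ _ _ _).2 t1) ((ev_lv α hα _ _ _).not.2 t2)
      ((ev_lv α hα _ _ _).not.2 t3) ((ev_lv β hβ _ _ _).not.2 t4) ((ev_lv β hβ _ _ _).not.2 t3)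
      (N k) (N m) (φ k) (φ m) (hN k hk).2.1 (hN m hm).2.1 (hN k hk).2.2 (hN m hm).2.2
    exact ⟨K.1, K.2 _ _ ((hP a b hab _).2 t5) ((hP c d hcd _).2 t6) ((hP a b hab _).not.2 t7)
      ((hP c d hcd _).not.2 t8) ((hP a b hab _).not.2 t9) ((hP c d hcd _).not.2 t10)⟩
  have cert := certificate (fun k a b => φ k (P a b)) (fun l k m a b c d hc =>
    (R l k m a b c d hc).2)
  have N17 : N 7 = N 1 := by
    have e1 := (R 2 1 6 0 2 0 2 (by decide +kernel)).1
    have e2 := (R 4 6 7 0 3 0 3 (by decide +kernel)).1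
    rw [e1, e2]
  have Hp := hP 2 4 (by decide)
  have Hq := hP 3 5 (by decide)
  set p := P 2 4
  set q := P 3 5
  have p1 : p ∈ (ln (lv α 1) ∪ ln (lv α 10))ᶜ := by
    simp only [Set.mem_compl_iff, Set.mem_union, Hp]; decide +kernel
  have p7 : p ∈ (ln (lv α 7) ∪ ln (lv α 10))ᶜ := by
    simp only [Set.mem_compl_iff, Set.mem_union, Hp]; decide +kernel
  have q1 : q ∈ (ln (lv α 1) ∪ ln (lv α 10))ᶜ := by
    simp only [Set.mem_compl_iff, Set.mem_union, Hq]; decide +kernel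
  have q7 : q ∈ (ln (lv α 7) ∪ ln (lv α 10))ᶜ := by
    simp only [Set.mem_compl_iff, Set.mem_union, Hq]; decide +kernel
  have mp2 : p ∈ ln (lv α 2) := (Hp 2).2 (by decide +kernel)
  have mp4 : p ∈ ln (lv α 4) := (Hp 4).2 (by decide +kernel)
  have mq3 : q ∈ ln (lv α 3) := (Hq 3).2 (by decide +kernel)
  have mq5 : q ∈ ln (lv α 5) := (Hq 5).2 (by decide +kernel)
  have X := cross α hα p q mp2 mp4 mq3 mq5 (lv α 10)
  have X' := cross β hβ (h p) (h q) ((hf _ _).2 mp2) ((hf _ _).2 mp4) ((hf _ _).2 mq3)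
    ((hf _ _).2 mq5) (lv β 10)
  have h1 := hN 1 (by decide)
  have h7 := hN 7 (by decide)
  rw [N17] at h7
  rw [h1.2.2 p p1, h1.2.2 q q1, h7.2.2 p p7, h7.2.2 q q7] at X'
  refine ⟨N 1, h1.1, ?_⟩
  have nz : rt (lv α 7) (lv α 10) p * rt (lv α 1) (lv α 10) q ≠ 0 := by
    rw [not_mem_iff] at p7 q1
    exact mul_ne_zero (div_ne_zero p7.1 p7.2) (div_ne_zero q1.1 q1.2)
  have E : Complex.exp (φ 1 p) * Complex.exp (φ 7 q) = Complex.exp (φ 7 p) * Complex.exp (φ 1 q) := by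
    rw [← Complex.exp_add, cert, Complex.exp_add]
  have Y : (rt (lv α 1) (lv α 10) p * rt (lv α 7) (lv α 10) q) ^ N 1 *
      (Complex.exp (φ 1 p) * Complex.exp (φ 7 q)) =
      β * ((rt (lv α 7) (lv α 10) p * rt (lv α 1) (lv α 10) q) ^ N 1 *
      (Complex.exp (φ 7 p) * Complex.exp (φ 1 q))) := by
    rw [mul_zpow, mul_zpow]
    linear_combination X'
  rw [X, E, mul_zpow] at Y
  have nz2 : (rt (lv α 7) (lv α 10) p * rt (lv α 1) (lv α 10) q) ^ N 1 *
      (Complex.exp (φ 7 p) * Complex.exp (φ 1 q)) ≠ 0 :=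
    mul_ne_zero (zpow_ne_zero _ nz) (mul_ne_zero (Complex.exp_ne_zero _) (Complex.exp_ne_zero _))
  apply mul_right_cancel₀ nz2
  rw [← Y]; ring

lemma pow_root (ζ : ℂ) (hζ : ζ ^ 4 + ζ ^ 3 + ζ ^ 2 + ζ + 1 = 0) (i : ℕ)
    (hi : i ∈ Finset.Icc 1 4) :
    (ζ ^ i) ^ 4 + (ζ ^ i) ^ 3 + (ζ ^ i) ^ 2 + ζ ^ i + 1 = 0 := by
  have h5 : ζ ^ 5 = 1 := by linear_combination (ζ - 1) * hζ
  simp only [Finset.mem_Icc] at hi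
  obtain ⟨h1, h2⟩ := hi
  interval_cases i
  · simpa using hζ
  · linear_combination hζ + (ζ ^ 3 + ζ) * h5
  · linear_combination hζ + (ζ ^ 7 + ζ ^ 2 + ζ ^ 4 + ζ) * h5
  · linear_combination hζ + (ζ ^ 11 + ζ ^ 6 + ζ + ζ ^ 7 + ζ ^ 2 + ζ ^ 3) * h5


/-- For `i ≠ j ∈ {1,2,3,4}` with `i + j ≢ 0 (mod 5)`, there is no homeomorphism
of `ℂℙ²` with `h(Z(𝔐_i)) = Z(𝔐_j)`: the arrangements `𝔐_i` and `𝔐_j` form a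
Zariski pair. -/
theorem statement5 (ζ : ℂ) (hζ : ζ^4 + ζ^3 + ζ^2 + ζ + 1 = 0)
    (i j : ℕ) (hi : i ∈ Finset.Icc 1 4) (hj : j ∈ Finset.Icc 1 4)
    (hij : i ≠ j) (hmod : ¬ (5 ∣ i + j)) :
    ¬ ∃ h : CP2 ≃ₜ CP2, h '' (⋃ k, MMline (ζ^i) k) = ⋃ k, MMline (ζ^j) k := by
  rintro ⟨h, hh⟩
  have hα := pow_root ζ hζ i hi
  have hβ := pow_root ζ hζ j hj
  obtain ⟨N, hN, e⟩ := rigid _ _ hα hβ h (fix_lines _ _ hα hβ h hh)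
  have hp := prim5 ζ hζ
  simp only [Finset.mem_Icc] at hi hj
  rcases hN with rfl | rfl
  · rw [zpow_one] at e
    exact hij (hp.pow_inj (by omega) (by omega) e.symm)
  · apply hmod
    rw [← hp.pow_eq_one_iff_dvd, pow_add, e, zpow_neg, zpow_one]
    exact mul_inv_cancel₀ (pow_ne_zero _ (hp.ne_zero (by norm_num)))
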